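/- Lemma (Connes, Lemma 41 of 'Noncommutative differential geometry'). Let A be a unital associative algebra over ℂ. The spaces Im B = {Bψ : ψ ∈ C^{n+1}(A)} ⊆ C^n(A) and Ker B = {φ ∈ C^n(A) : Bφ = 0} ⊆ C^n(A) are each stable under the Hochschild differential b, and the inclusion of complexes (Im B, b) ↪ (Ker B, b) induces an isomorphism on cohomology in every degree. Consequently the b-cohomology of the quotient complex Ker B / Im B vanishes. -/

import Mathlib

noncomputable section
namespace NCG

abbrev Cochain (A : Type) (n : ℕ) : Type := (Fin (n + 1) → A) → ℂ

variable {A : Type} [Ring A] [Algebra ℂ A]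

def face {n : ℕ} (a : Fin (n + 2) → A) (i : Fin (n + 1)) : Fin (n + 1) → A :=
  fun j => if j < i then a j.castSucc else if j = i then a j.castSucc * a j.succ else a j.succ

def cyclicFace {n : ℕ} (a : Fin (n + 2) → A) : Fin (n + 1) → A :=
  fun j => if j = 0 then a (Fin.last (n + 1)) * a 0 else a j.castSucc

def bP {n : ℕ} (φ : Cochain A n) : Cochain A (n + 1) :=
  fun a => ∑ i : Fin (n + 1), (-1 : ℂ) ^ (i : ℕ) * φ (face a i)

def bH {n : ℕ} (φ : Cochain A n) : Cochain A (n + 1) :=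
  fun a => bP φ a + (-1 : ℂ) ^ (n + 1) * φ (cyclicFace a)

def lam {n : ℕ} (φ : Cochain A n) : Cochain A n :=
  fun a => (-1 : ℂ) ^ n * φ (fun j => a (j - 1))

def opN {n : ℕ} (φ : Cochain A n) : Cochain A n :=
  fun a => ∑ k ∈ Finset.range (n + 1), (lam^[k] φ) a

def opS {n : ℕ} (φ : Cochain A (n + 1)) : Cochain A n :=
  fun a => (-1 : ℂ) ^ n * φ (Fin.snoc a 1)

def opB0 {n : ℕ} (φ : Cochain A (n + 1)) : Cochain A n :=
  fun a => φ (Fin.cons 1 a) - (-1 : ℂ) ^ (n + 1) * φ (Fin.snoc a 1)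

def opB {n : ℕ} (φ : Cochain A (n + 1)) : Cochain A n := opN (opB0 φ)

def IsML {n : ℕ} (φ : Cochain A n) : Prop :=
  ∃ F : MultilinearMap ℂ (fun _ : Fin (n + 1) => A) ℂ, ⇑F = φ

/-- `φ ∈ Cⁿ(A)` lies in `Ker B` (in degree `0` the operator `B` is zero, so the
condition is vacuous). -/
def InKerB : ∀ {n : ℕ}, Cochain A n → Prop
  | 0, _ => True
  | _ + 1, φ => opB φ = 0

/-- `φ ∈ Cⁿ(A)` lies in `Im B`, i.e. `φ = Bψ` for some multilinear `ψ ∈ Cⁿ⁺¹(A)`. -/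
def InImB {n : ℕ} (φ : Cochain A n) : Prop :=
  ∃ ψ : Cochain A (n + 1), IsML ψ ∧ opB ψ = φ

set_option linter.unusedSectionVars false

/-- The `i`-th signed face operator; the index `n + 1` is the cyclic face. -/
def sface (n i : ℕ) : Cochain A n →ₗ[ℂ] Cochain A (n + 1) where
  toFun φ a := if h : i < n + 1 then (-1 : ℂ) ^ i * φ (face a ⟨i, h⟩)
    else (-1 : ℂ) ^ (n + 1) * φ (cyclicFace a)
  map_add' φ ψ := by ext a; by_cases h : i < n + 1 <;> simp [h, mul_add]
  map_smul' c φ := by ext a; by_cases h : i < n + 1 <;> simp [h, mul_left_comm]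

def lamL (n : ℕ) : Module.End ℂ (Cochain A n) where
  toFun := lam
  map_add' φ ψ := by ext a; simp [lam, mul_add]
  map_smul' c φ := by ext a; simp [lam, mul_left_comm]

def normL (n : ℕ) : Module.End ℂ (Cochain A n) := ∑ k ∈ Finset.range (n + 1), lamL n ^ k

def unitFirst (n : ℕ) : Cochain A (n + 1) →ₗ[ℂ] Cochain A n where
  toFun φ a := φ (Fin.cons 1 a)
  map_add' _ _ := rfl
  map_smul' _ _ := rfl

def unitLast (n : ℕ) : Cochain A (n + 1) →ₗ[ℂ] Cochain A n where
  toFun φ a := φ (Fin.snoc a 1)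
  map_add' _ _ := rfl
  map_smul' _ _ := rfl

def opB0L (n : ℕ) : Cochain A (n + 1) →ₗ[ℂ] Cochain A n :=
  unitFirst n - (-1 : ℂ) ^ (n + 1) • unitLast n

def bPL (n : ℕ) : Cochain A n →ₗ[ℂ] Cochain A (n + 1) := ∑ i ∈ Finset.range (n + 1), sface n i

def bHL (n : ℕ) : Cochain A n →ₗ[ℂ] Cochain A (n + 1) := ∑ i ∈ Finset.range (n + 2), sface n i

lemma opB0L_apply {n : ℕ} (φ : Cochain A (n + 1)) : opB0L n φ = opB0 φ := rfl

lemma bPL_apply {n : ℕ} (φ : Cochain A n) : bPL n φ = bP φ := by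
  ext a
  simp only [bPL, LinearMap.sum_apply, Finset.sum_apply, bP, Finset.sum_range, sface,
    LinearMap.coe_mk, AddHom.coe_mk, Fin.is_lt, dite_true, Fin.eta]

lemma bHL_eq (n : ℕ) : bHL (A := A) n = bPL n + sface n (n + 1) := by
  rw [bHL, Finset.sum_range_succ, bPL]

lemma bHL_apply {n : ℕ} (φ : Cochain A n) : bHL n φ = bH φ := by
  rw [bHL_eq]
  ext a
  simp [bPL_apply, bH, sface]

lemma normL_apply {n : ℕ} (φ : Cochain A n) : normL n φ = opN φ := by
  ext a
  simp only [normL, LinearMap.sum_apply, Finset.sum_apply, opN, Module.End.pow_apply]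
  rfl

lemma opB_eq {n : ℕ} (φ : Cochain A (n + 1)) : opB φ = normL n (opB0L n φ) :=
  (normL_apply _).symm

lemma exists_nat_extension {X : Type} [Zero X] {m : ℕ} (a : Fin m → X) :
    ∃ f : ℕ → X, a = fun i : Fin m => f i :=
  ⟨fun k => if h : k < m then a ⟨k, h⟩ else 0, by ext i; simp⟩

lemma val_sub_one {n : ℕ} (j : Fin (n + 1)) :
    ((j - 1 : Fin (n + 1)) : ℕ) = if (j : ℕ) = 0 then n else j - 1 := by
  by_cases h : j = 0
  · subst h; simp [Fin.coe_neg_one]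
  · rw [Fin.coe_sub_one]; simp [h]

lemma face_zero_rotate {n : ℕ} (a : Fin (n + 2) → A) :
    face (fun j => a (j - 1)) 0 = cyclicFace a := by
  obtain ⟨f, rfl⟩ := exists_nat_extension a
  ext j
  simp only [face, cyclicFace, val_sub_one, Fin.lt_def, Fin.ext_iff, Fin.val_castSucc, Fin.val_succ,
    Fin.val_zero, Fin.val_last]
  grind

lemma face_succ_rotate {n : ℕ} (a : Fin (n + 2) → A) (i : ℕ) (hi : i + 1 < n + 1) :
    face (fun j => a (j - 1)) ⟨i + 1, hi⟩ = fun j => face a ⟨i, by omega⟩ (j - 1) := by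
  obtain ⟨f, rfl⟩ := exists_nat_extension a
  ext j
  simp only [face, val_sub_one, Fin.lt_def, Fin.ext_iff, Fin.val_castSucc, Fin.val_succ]
  grind

lemma cyclicFace_rotate {n : ℕ} (a : Fin (n + 2) → A) :
    cyclicFace (fun j => a (j - 1)) = fun j => face a ⟨n, by omega⟩ (j - 1) := by
  obtain ⟨f, rfl⟩ := exists_nat_extension a
  ext j
  simp only [face, cyclicFace, val_sub_one, Fin.lt_def, Fin.ext_iff, Fin.val_castSucc, Fin.val_succ,
    Fin.val_zero, Fin.val_last]
  grind

lemma face_face {n : ℕ} (a : Fin (n + 3) → A) (i j : ℕ) (hij : i ≤ j) (hj : j < n + 1) :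
    face (face a ⟨j + 1, by omega⟩) ⟨i, by omega⟩ = face (face a ⟨i, by omega⟩) ⟨j, hj⟩ := by
  obtain ⟨f, rfl⟩ := exists_nat_extension a
  ext k
  simp only [face, Fin.lt_def, Fin.ext_iff, Fin.val_castSucc, Fin.val_succ]
  grind [mul_assoc]

lemma face_cyclicFace {n : ℕ} (a : Fin (n + 3) → A) (i : ℕ) (hi : i < n + 1) :
    face (cyclicFace a) ⟨i, hi⟩ = cyclicFace (face a ⟨i, by omega⟩) := by
  obtain ⟨f, rfl⟩ := exists_nat_extension a
  ext k
  simp only [face, cyclicFace, Fin.lt_def, Fin.ext_iff, Fin.val_castSucc, Fin.val_succ,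
    Fin.val_zero, Fin.val_last]
  grind [mul_assoc]

lemma cyclicFace_cyclicFace {n : ℕ} (a : Fin (n + 3) → A) :
    cyclicFace (cyclicFace a) = cyclicFace (face a ⟨n + 1, by omega⟩) := by
  obtain ⟨f, rfl⟩ := exists_nat_extension a
  ext k
  simp only [face, cyclicFace, Fin.lt_def, Fin.ext_iff, Fin.val_castSucc, Fin.val_succ,
    Fin.val_zero, Fin.val_last]
  grind [mul_assoc]

lemma cons_one_eq {n : ℕ} (f : ℕ → A) :
    (Fin.cons 1 (fun i : Fin n => f i) : Fin (n + 1) → A) =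
      fun j : Fin (n + 1) => if (j : ℕ) = 0 then 1 else f (j - 1) := by
  ext j
  refine Fin.cases ?_ (fun j => ?_) j <;> simp

lemma snoc_one_eq {n : ℕ} (f : ℕ → A) :
    (Fin.snoc (fun i : Fin n => f i) 1 : Fin (n + 1) → A) =
      fun j : Fin (n + 1) => if (j : ℕ) = n then 1 else f j := by
  ext j
  refine Fin.lastCases ?_ (fun j => ?_) j
  · simp
  · simp [j.2.ne]

lemma face_zero_cons_one {n : ℕ} (a : Fin (n + 1) → A) : face (Fin.cons 1 a) 0 = a := by
  obtain ⟨f, rfl⟩ := exists_nat_extension a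
  rw [cons_one_eq]
  ext j
  simp only [face, Fin.lt_def, Fin.ext_iff, Fin.val_castSucc, Fin.val_succ, Fin.val_zero]
  grind

lemma face_succ_cons_one {n : ℕ} (a : Fin (n + 2) → A) (i : ℕ) (hi : i < n + 1) :
    face (Fin.cons 1 a) ⟨i + 1, by omega⟩ = Fin.cons 1 (face a ⟨i, hi⟩) := by
  obtain ⟨f, rfl⟩ := exists_nat_extension a
  rw [cons_one_eq]
  ext j
  refine Fin.cases ?_ (fun j => ?_) j
  · simp [face, Fin.lt_def]
  · simp only [face, Fin.cons_succ, Fin.lt_def, Fin.ext_iff, Fin.val_castSucc, Fin.val_succ]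
    grind

lemma cyclicFace_cons_one {n : ℕ} (a : Fin (n + 1) → A) :
    cyclicFace (Fin.cons 1 a) = fun j => a (j - 1) := by
  obtain ⟨f, rfl⟩ := exists_nat_extension a
  rw [cons_one_eq]
  ext j
  simp only [cyclicFace, val_sub_one, Fin.ext_iff, Fin.val_castSucc,
    Fin.val_zero, Fin.val_last]
  grind

lemma face_snoc_one {n : ℕ} (a : Fin (n + 2) → A) (i : ℕ) (hi : i < n + 1) :
    face (Fin.snoc a 1) ⟨i, by omega⟩ = Fin.snoc (face a ⟨i, hi⟩) 1 := by
  obtain ⟨f, rfl⟩ := exists_nat_extension a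
  rw [snoc_one_eq]
  ext j
  refine Fin.lastCases ?_ (fun j => ?_) j
  · simp only [face, Fin.snoc_last, Fin.lt_def, Fin.ext_iff, Fin.val_castSucc, Fin.val_succ,
      Fin.val_last]
    grind
  · simp only [face, Fin.snoc_castSucc, Fin.lt_def, Fin.ext_iff, Fin.val_castSucc, Fin.val_succ]
    grind

lemma face_last_snoc_one {n : ℕ} (a : Fin (n + 1) → A) :
    face (Fin.snoc a 1) ⟨n, by omega⟩ = a := by
  obtain ⟨f, rfl⟩ := exists_nat_extension a
  rw [snoc_one_eq]
  ext j
  simp only [face, Fin.lt_def, Fin.ext_iff, Fin.val_castSucc, Fin.val_succ]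
  grind

lemma cyclicFace_snoc_one {n : ℕ} (a : Fin (n + 1) → A) : cyclicFace (Fin.snoc a 1) = a := by
  obtain ⟨f, rfl⟩ := exists_nat_extension a
  rw [snoc_one_eq]
  ext j
  simp only [cyclicFace, Fin.ext_iff, Fin.val_castSucc, Fin.val_zero, Fin.val_last]
  grind

lemma lamL_pow_apply (n k : ℕ) (φ : Cochain A n) (a : Fin (n + 1) → A) :
    (lamL n ^ k) φ a = (-1 : ℂ) ^ (n * k) * φ (fun j => a (j - k • 1)) := by
  induction k generalizing a with
  | zero => simp
  | succ k ih =>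
    rw [pow_succ', Module.End.mul_apply]
    change (-1 : ℂ) ^ n * (lamL n ^ k) φ (fun j => a (j - 1)) = _
    rw [ih, ← mul_assoc, ← pow_add, succ_nsmul]
    simp only [sub_sub, mul_add, mul_one, add_comm]

lemma lamL_pow_card (n : ℕ) : lamL (A := A) n ^ (n + 1) = 1 := by
  ext φ a
  have h : (n + 1) • (1 : Fin (n + 1)) = 0 := by
    simpa using card_nsmul_eq_zero (x := (1 : Fin (n + 1)))
  rw [lamL_pow_apply, h, (Nat.even_mul_succ_self n).neg_one_pow]
  simp

lemma lamL_mul_normL (n : ℕ) : lamL (A := A) n * normL n = normL n := by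
  have h := mul_geom_sum (lamL (A := A) n) (n + 1)
  rwa [lamL_pow_card, sub_self, sub_mul, one_mul, sub_eq_zero] at h

lemma normL_mul_lamL (n : ℕ) : normL n * lamL (A := A) n = normL n := by
  have h := geom_sum_mul (lamL (A := A) n) (n + 1)
  rwa [lamL_pow_card, sub_self, mul_sub, mul_one, sub_eq_zero] at h

lemma lamL_normL {n : ℕ} (φ : Cochain A n) : lamL n (normL n φ) = normL n φ :=
  LinearMap.congr_fun (lamL_mul_normL n) φ

lemma normL_lamL {n : ℕ} (φ : Cochain A n) : normL n (lamL n φ) = normL n φ :=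
  LinearMap.congr_fun (normL_mul_lamL n) φ

lemma lamL_pow_normL {n : ℕ} (k : ℕ) (φ : Cochain A n) :
    (lamL n ^ k) (normL n φ) = normL n φ := by
  induction k with
  | zero => rfl
  | succ k ih => rw [pow_succ, Module.End.mul_apply, lamL_normL, ih]

lemma normL_lamL_pow {n : ℕ} (k : ℕ) (φ : Cochain A n) :
    normL n ((lamL n ^ k) φ) = normL n φ := by
  induction k with
  | zero => rfl
  | succ k ih => rw [pow_succ', Module.End.mul_apply, normL_lamL, ih]

lemma normL_of_cyclic {n : ℕ} {φ : Cochain A n} (h : lamL n φ = φ) :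
    normL n φ = ((n : ℂ) + 1) • φ := by
  have hk (k : ℕ) : (lamL n ^ k) φ = φ := by
    induction k with
    | zero => rfl
    | succ k ih => rw [pow_succ, Module.End.mul_apply, h, ih]
  simp only [normL, LinearMap.sum_apply, hk, Finset.sum_const, Finset.card_range]
  rw [← Nat.cast_smul_eq_nsmul ℂ]
  simp

/-- An operator inverting `1 - λ` on the kernel of `N`. -/
def coboundL (n : ℕ) : Module.End ℂ (Cochain A n) :=
  ((n : ℂ) + 1)⁻¹ • ∑ k ∈ Finset.range (n + 1), ∑ j ∈ Finset.range k, lamL n ^ j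

lemma sub_lamL_coboundL {n : ℕ} {φ : Cochain A n} (h : normL n φ = 0) :
    coboundL n φ - lamL n (coboundL n φ) = φ := by
  have key : (1 - lamL (A := A) n) * coboundL n = 1 - ((n : ℂ) + 1)⁻¹ • normL n := by
    have hn : (n : ℂ) + 1 ≠ 0 := Nat.cast_add_one_ne_zero n
    rw [coboundL, mul_smul_comm, Finset.mul_sum]
    simp only [mul_neg_geom_sum, Finset.sum_sub_distrib, Finset.sum_const, Finset.card_range,
      smul_sub, normL]
    rw [← Nat.cast_smul_eq_nsmul ℂ, smul_smul]
    push_cast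
    rw [inv_mul_cancel₀ hn, one_smul]
  have := LinearMap.congr_fun key φ
  simpa [h] using this

lemma sface_apply_of_lt {n i : ℕ} (h : i < n + 1) (φ : Cochain A n) (a : Fin (n + 2) → A) :
    sface n i φ a = (-1 : ℂ) ^ i * φ (face a ⟨i, h⟩) := by
  simp [sface, h]

lemma sface_apply_last {n : ℕ} (φ : Cochain A n) (a : Fin (n + 2) → A) :
    sface n (n + 1) φ a = (-1 : ℂ) ^ (n + 1) * φ (cyclicFace a) := by
  simp [sface]

lemma lamL_apply {n : ℕ} (φ : Cochain A n) (a : Fin (n + 1) → A) :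
    lamL n φ a = (-1 : ℂ) ^ n * φ (fun j => a (j - 1)) := rfl

lemma lamL_sface_zero {n : ℕ} (φ : Cochain A n) :
    lamL (n + 1) (sface n 0 φ) = sface n (n + 1) φ := by
  ext a
  rw [lamL_apply, sface_apply_of_lt n.succ_pos, sface_apply_last, ← face_zero_rotate]
  simp

lemma lamL_sface_succ {n i : ℕ} (hi : i ≤ n) (φ : Cochain A n) :
    lamL (n + 1) (sface n (i + 1) φ) = sface n i (lamL n φ) := by
  ext a
  rw [lamL_apply, sface_apply_of_lt (Nat.lt_succ_of_le hi), lamL_apply]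
  rcases hi.lt_or_eq with h | rfl
  · rw [sface_apply_of_lt (Nat.succ_lt_succ h), face_succ_rotate, pow_succ _ i, pow_succ _ n]
    ring
  · rw [sface_apply_last, cyclicFace_rotate]
    simp only [← mul_assoc, ← pow_add]
    congr 1
    rw [← mul_one ((-1 : ℂ) ^ (i + i)), show i + 1 + (i + 1) = i + i + 2 by ring, pow_add]
    simp

lemma lamL_pow_sface {n i : ℕ} (hi : i ≤ n + 1) (φ : Cochain A n) :
    (lamL (n + 1) ^ i) (sface n i φ) = sface n 0 ((lamL n ^ i) φ) := by
  induction i generalizing φ with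
  | zero => rfl
  | succ i ih =>
    rw [pow_succ, Module.End.mul_apply, lamL_sface_succ (by omega), ih (by omega),
      pow_succ, Module.End.mul_apply]

lemma bHL_sub_lamL {n : ℕ} (φ : Cochain A n) :
    bHL n φ - lamL (n + 1) (bHL n φ) = bPL n (φ - lamL n φ) := by
  have h : lamL (n + 1) (bHL n φ) = bPL n (lamL n φ) + sface n (n + 1) φ := by
    simp only [bHL, bPL, LinearMap.sum_apply, map_sum]
    rw [Finset.sum_range_succ', lamL_sface_zero]
    congr 1
    exact Finset.sum_congr rfl fun i hi =>
      lamL_sface_succ (Nat.lt_succ_iff.mp (Finset.mem_range.mp hi)) φ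
  rw [h, map_sub, bHL_eq, LinearMap.add_apply]
  abel

lemma normL_bPL {n : ℕ} (φ : Cochain A n) :
    normL (n + 1) (bPL n φ) = bHL n (normL n φ) := by
  have h1 : normL (n + 1) (bPL n φ) = normL (n + 1) (sface n 0 (normL n φ)) := by
    simp only [bPL, LinearMap.sum_apply, map_sum]
    conv_rhs => rw [show normL n φ = _ from LinearMap.sum_apply _ _ _, map_sum, map_sum]
    refine Finset.sum_congr rfl fun i hi => ?_
    rw [← lamL_pow_sface (Finset.mem_range.mp hi).le]
    exact (normL_lamL_pow i _).symm
  rw [h1, normL, bHL, LinearMap.sum_apply, LinearMap.sum_apply, Finset.sum_range_succ' _ (n + 1),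
    Finset.sum_range_succ' _ (n + 1), ← Finset.sum_range_reflect]
  congr 1
  refine Finset.sum_congr rfl fun i hi => ?_
  have hi' : i < n + 1 := Finset.mem_range.mp hi
  have h2 : (lamL (n + 1) ^ (i + 1)) (sface n (i + 1) (normL n φ)) = sface n 0 (normL n φ) := by
    rw [lamL_pow_sface (by omega), lamL_pow_normL]
  rw [← h2, ← Module.End.mul_apply, ← pow_add, show n + 1 - 1 - i + 1 + (i + 1) = n + 1 + 1 by omega,
    lamL_pow_card, Module.End.one_apply]

lemma unitFirst_bPL_zero (φ : Cochain A 0) : unitFirst 0 (bPL 0 φ) = φ := by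
  ext a
  change bPL 0 φ (Fin.cons 1 a) = _
  simp only [bPL, zero_add, Finset.range_one, Finset.sum_singleton]
  rw [sface_apply_of_lt zero_lt_one]
  simp only [pow_zero, one_mul]
  exact congrArg φ (face_zero_cons_one a)

lemma unitFirst_bPL {n : ℕ} (φ : Cochain A (n + 1)) :
    unitFirst (n + 1) (bPL (n + 1) φ) = φ - bPL n (unitFirst n φ) := by
  ext a
  change bPL (n + 1) φ (Fin.cons 1 a) = _
  simp only [bPL, LinearMap.sum_apply, Finset.sum_apply, Pi.sub_apply]
  rw [Finset.sum_range_succ', sface_apply_of_lt (by omega), pow_zero, one_mul, add_comm,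
    sub_eq_add_neg, ← Finset.sum_neg_distrib]
  congr 1
  · exact congrArg φ (face_zero_cons_one a)
  · refine Finset.sum_congr rfl fun i hi => ?_
    have hi' : i < n + 1 := Finset.mem_range.mp hi
    rw [sface_apply_of_lt (by omega), sface_apply_of_lt hi', face_succ_cons_one a i hi', pow_succ]
    simp [unitFirst]

lemma unitFirst_sface_last {n : ℕ} (φ : Cochain A n) :
    unitFirst n (sface n (n + 1) φ) = - lamL n φ := by
  ext a
  change sface n (n + 1) φ (Fin.cons 1 a) = _
  rw [sface_apply_last, cyclicFace_cons_one, pow_succ]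
  simp [lamL_apply]

lemma unitLast_bHL_zero (φ : Cochain A 0) : unitLast 0 (bHL 0 φ) = 0 := by
  ext a
  change bHL 0 φ (Fin.snoc a 1) = _
  have h0 (b) : bHL 0 φ b = sface 0 0 φ b + sface 0 (0 + 1) φ b := by
    simp [bHL, Finset.sum_range_succ]
  have h1 := sface_apply_of_lt zero_lt_one φ (Fin.snoc a 1)
  have h2 := sface_apply_last φ (Fin.snoc a 1)
  rw [face_last_snoc_one] at h1
  rw [cyclicFace_snoc_one] at h2
  rw [h0, h1, h2]
  simp

lemma unitLast_bHL {n : ℕ} (φ : Cochain A (n + 1)) :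
    unitLast (n + 1) (bHL (n + 1) φ) = bPL n (unitLast n φ) := by
  ext a
  change bHL (n + 1) φ (Fin.snoc a 1) = _
  simp only [bHL, bPL, LinearMap.sum_apply, Finset.sum_apply]
  rw [Finset.sum_range_succ, Finset.sum_range_succ, sface_apply_last,
    sface_apply_of_lt (by omega), face_last_snoc_one, cyclicFace_snoc_one, add_assoc,
    show (-1 : ℂ) ^ (n + 1) * φ a + (-1) ^ (n + 1 + 1) * φ a = 0 by ring, add_zero]
  refine Finset.sum_congr rfl fun i hi => ?_
  have hi' : i < n + 1 := Finset.mem_range.mp hi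
  rw [sface_apply_of_lt (by omega), sface_apply_of_lt hi', face_snoc_one a i hi']
  rfl

lemma opB0L_bHL_zero (φ : Cochain A 0) : opB0L 0 (bHL 0 φ) = φ - lamL 0 φ := by
  rw [opB0L, LinearMap.sub_apply, LinearMap.smul_apply, unitLast_bHL_zero, bHL_eq,
    LinearMap.add_apply, map_add, unitFirst_bPL_zero, unitFirst_sface_last, smul_zero, sub_zero,
    sub_eq_add_neg]

lemma opB0L_bHL {n : ℕ} (φ : Cochain A (n + 1)) :
    opB0L (n + 1) (bHL (n + 1) φ) = φ - lamL (n + 1) φ - bPL n (opB0L n φ) := by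
  rw [opB0L, LinearMap.sub_apply, LinearMap.smul_apply, unitLast_bHL, bHL_eq,
    LinearMap.add_apply, map_add, unitFirst_bPL, unitFirst_sface_last, opB0L, LinearMap.sub_apply,
    LinearMap.smul_apply, map_sub, map_smul, pow_succ _ (n + 1), mul_neg_one, neg_smul]
  abel

lemma sface_sface {n i j : ℕ} (hij : i ≤ j) (hj : j < n + 2) (φ : Cochain A n) :
    sface (n + 1) (j + 1) (sface n i φ) = - sface (n + 1) i (sface n j φ) := by
  ext a
  rw [Pi.neg_apply, sface_apply_of_lt (i := i) (n := n + 1) (by omega)]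
  rcases (Nat.lt_succ_iff.mp hj).lt_or_eq with h | rfl
  · rw [sface_apply_of_lt (by omega), sface_apply_of_lt (by omega), sface_apply_of_lt h,
      face_face a i j hij h]
    ring
  · rw [sface_apply_last, sface_apply_last]
    rcases hij.lt_or_eq with h | rfl
    · rw [sface_apply_of_lt h, face_cyclicFace]
      ring
    · rw [sface_apply_last, cyclicFace_cyclicFace]
      ring

lemma sum_range_eq_zero_of_alternating {M : Type} [AddCommGroup M] (f : ℕ → ℕ → M) (m : ℕ)
    (h : ∀ i j, i ≤ j → j < m → f (j + 1) i = - f i j) :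
    ∑ p ∈ Finset.range (m + 1), ∑ q ∈ Finset.range m, f p q = 0 := by
  induction m with
  | zero => simp
  | succ m ih =>
    rw [Finset.sum_range_succ, Finset.sum_congr rfl fun p _ => Finset.sum_range_succ (f p) m,
      Finset.sum_add_distrib, ih fun i j hij hj => h i j hij (by omega),
      Finset.sum_congr rfl fun i hi =>
        h i m (Nat.lt_succ_iff.mp (Finset.mem_range.mp hi)) m.lt_succ_self,
      Finset.sum_neg_distrib]
    abel

lemma bHL_bHL {n : ℕ} (φ : Cochain A n) : bHL (n + 1) (bHL n φ) = 0 := by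
  simp only [bHL, LinearMap.sum_apply, map_sum]
  rw [Finset.sum_comm]
  exact sum_range_eq_zero_of_alternating (fun p q => sface (n + 1) p (sface n q φ)) (n + 2)
    fun i j hij hj => sface_sface hij hj φ

lemma normL_opB0L_bHL_zero (φ : Cochain A 0) : normL 0 (opB0L 0 (bHL 0 φ)) = 0 := by
  rw [opB0L_bHL_zero, map_sub, normL_lamL, sub_self]

lemma normL_opB0L_bHL {n : ℕ} (φ : Cochain A (n + 1)) :
    normL (n + 1) (opB0L (n + 1) (bHL (n + 1) φ)) = - bHL n (normL n (opB0L n φ)) := by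
  rw [opB0L_bHL, map_sub, map_sub, normL_lamL, sub_self, zero_sub, normL_bPL]

lemma snoc_one_rotate {n : ℕ} (a : Fin (n + 1) → A) :
    (fun j => (Fin.snoc a 1 : Fin (n + 2) → A) (j - 1)) = Fin.cons 1 a := by
  obtain ⟨f, rfl⟩ := exists_nat_extension a
  rw [cons_one_eq, snoc_one_eq]
  ext j
  simp only [val_sub_one]
  grind

lemma opB0L_of_cyclic {n : ℕ} {φ : Cochain A (n + 1)} (h : lamL (n + 1) φ = φ) :
    opB0L n φ = 0 := by
  ext a
  have h3 := congrFun h (Fin.snoc a 1)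
  rw [lamL_apply, snoc_one_rotate] at h3
  change φ (Fin.cons 1 a) - (-1 : ℂ) ^ (n + 1) * φ (Fin.snoc a 1) = 0
  rw [← h3, ← mul_assoc, ← pow_add, Even.neg_one_pow ⟨_, rfl⟩]
  simp

def mlSub (A : Type) [Ring A] [Algebra ℂ A] (n : ℕ) : Submodule ℂ (Cochain A n) where
  carrier := {φ | IsML φ}
  add_mem' := by
    rintro _ _ ⟨F, rfl⟩ ⟨G, rfl⟩
    exact ⟨F + G, rfl⟩
  zero_mem' := ⟨0, rfl⟩
  smul_mem' := by
    rintro c _ ⟨F, rfl⟩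
    exact ⟨c • F, rfl⟩

lemma mem_mlSub {n : ℕ} {φ : Cochain A n} : φ ∈ mlSub A n ↔ IsML φ := Iff.rfl

lemma comp_mem_mlSub {m n : ℕ} {φ : Cochain A n} (hφ : φ ∈ mlSub A n)
    (g : (Fin (m + 1) → A) → Fin (n + 1) → A)
    (hg : ∀ a k, ∃ k', ∃ L : A →ₗ[ℂ] A, ∀ x,
      g (Function.update a k x) = Function.update (g a) k' (L x)) :
    (fun a => φ (g a)) ∈ mlSub A m := by
  obtain ⟨F, rfl⟩ := hφ
  refine ⟨MultilinearMap.mk' (fun a => F (g a)) (fun a k x y => ?_) (fun a k c x => ?_), rfl⟩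
  · obtain ⟨k', L, h⟩ := hg a k
    simp only [h, map_add, F.map_update_add]
  · obtain ⟨k', L, h⟩ := hg a k
    simp only [h, map_smul, F.map_update_smul]

lemma lamL_mem {n : ℕ} {φ : Cochain A n} (hφ : φ ∈ mlSub A n) : lamL n φ ∈ mlSub A n := by
  refine (mlSub A n).smul_mem ((-1 : ℂ) ^ n)
    (comp_mem_mlSub hφ (fun a j => a (j - 1)) fun a k => ⟨k + 1, LinearMap.id, fun x => ?_⟩)
  ext j
  simp [Function.update_apply, sub_eq_iff_eq_add]

lemma face_update {n : ℕ} (a : Fin (n + 2) → A) (i : Fin (n + 1)) (k : Fin (n + 2)) :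
    ∃ k', ∃ L : A →ₗ[ℂ] A, ∀ x,
      face (Function.update a k x) i = Function.update (face a i) k' (L x) := by
  obtain ⟨f, rfl⟩ := exists_nat_extension a
  have hi := i.2
  have hk := k.2
  rcases lt_trichotomy (k : ℕ) i with h | h | h
  · refine ⟨⟨k, by omega⟩, LinearMap.id, fun x => ?_⟩
    ext j
    simp only [face, Function.update_apply, Fin.lt_def, Fin.ext_iff, Fin.val_castSucc,
      Fin.val_succ, LinearMap.id_apply]
    grind
  · refine ⟨i, LinearMap.mulRight ℂ (f (i + 1)), fun x => ?_⟩
    ext j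
    simp only [face, Function.update_apply, Fin.lt_def, Fin.ext_iff, Fin.val_castSucc,
      Fin.val_succ, LinearMap.mulRight_apply]
    grind
  · by_cases h' : (k : ℕ) = i + 1
    · refine ⟨i, LinearMap.mulLeft ℂ (f i), fun x => ?_⟩
      ext j
      simp only [face, Function.update_apply, Fin.lt_def, Fin.ext_iff, Fin.val_castSucc,
        Fin.val_succ, LinearMap.mulLeft_apply]
      grind
    · refine ⟨⟨k - 1, by omega⟩, LinearMap.id, fun x => ?_⟩
      ext j
      simp only [face, Function.update_apply, Fin.lt_def, Fin.ext_iff, Fin.val_castSucc,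
        Fin.val_succ, LinearMap.id_apply]
      grind

lemma sface_mem {n i : ℕ} (hi : i ≤ n + 1) {φ : Cochain A n} (hφ : φ ∈ mlSub A n) :
    sface n i φ ∈ mlSub A (n + 1) := by
  have key {i : ℕ} (h : i < n + 1) : sface n i φ ∈ mlSub A (n + 1) := by
    have := (mlSub A (n + 1)).smul_mem ((-1 : ℂ) ^ i)
      (comp_mem_mlSub hφ (fun a => face a ⟨i, h⟩) fun a k => face_update a ⟨i, h⟩ k)
    convert this using 1
    ext a
    exact sface_apply_of_lt h φ a
  rcases hi.lt_or_eq with h | rfl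
  · exact key h
  · rw [← lamL_sface_zero]
    exact lamL_mem (key n.succ_pos)

lemma bPL_mem {n : ℕ} {φ : Cochain A n} (hφ : φ ∈ mlSub A n) : bPL n φ ∈ mlSub A (n + 1) := by
  rw [bPL, LinearMap.sum_apply]
  exact Submodule.sum_mem _ fun i hi => sface_mem (Finset.mem_range.mp hi).le hφ

lemma bHL_mem {n : ℕ} {φ : Cochain A n} (hφ : φ ∈ mlSub A n) : bHL n φ ∈ mlSub A (n + 1) := by
  rw [bHL_eq]
  exact Submodule.add_mem _ (bPL_mem hφ) (sface_mem le_rfl hφ)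

lemma lamL_pow_mem {n : ℕ} (k : ℕ) {φ : Cochain A n} (hφ : φ ∈ mlSub A n) :
    (lamL n ^ k) φ ∈ mlSub A n := by
  induction k with
  | zero => exact hφ
  | succ k ih =>
    rw [pow_succ', Module.End.mul_apply]
    exact lamL_mem ih

lemma normL_mem {n : ℕ} {φ : Cochain A n} (hφ : φ ∈ mlSub A n) : normL n φ ∈ mlSub A n := by
  rw [normL, LinearMap.sum_apply]
  exact Submodule.sum_mem _ fun k _ => lamL_pow_mem k hφ

lemma coboundL_mem {n : ℕ} {φ : Cochain A n} (hφ : φ ∈ mlSub A n) :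
    coboundL n φ ∈ mlSub A n := by
  rw [coboundL, LinearMap.smul_apply, LinearMap.sum_apply]
  refine Submodule.smul_mem _ _ (Submodule.sum_mem _ fun k _ => ?_)
  rw [LinearMap.sum_apply]
  exact Submodule.sum_mem _ fun j _ => lamL_pow_mem j hφ

lemma unitFirst_mem {n : ℕ} {φ : Cochain A (n + 1)} (hφ : φ ∈ mlSub A (n + 1)) :
    unitFirst n φ ∈ mlSub A n :=
  comp_mem_mlSub hφ (fun a => Fin.cons 1 a) fun a k => ⟨k.succ, LinearMap.id, fun x =>
    Fin.cons_update (α := fun _ => A) 1 a k x⟩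

lemma unitLast_mem {n : ℕ} {φ : Cochain A (n + 1)} (hφ : φ ∈ mlSub A (n + 1)) :
    unitLast n φ ∈ mlSub A n :=
  comp_mem_mlSub hφ (fun a => Fin.snoc a 1) fun a k => ⟨k.castSucc, LinearMap.id, fun x =>
    Fin.snoc_update (α := fun _ => A) 1 a k x⟩

lemma opB0L_mem {n : ℕ} {φ : Cochain A (n + 1)} (hφ : φ ∈ mlSub A (n + 1)) :
    opB0L n φ ∈ mlSub A n :=
  Submodule.sub_mem _ (unitFirst_mem hφ) (Submodule.smul_mem _ _ (unitLast_mem hφ))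

lemma tensorFirst_mem {n : ℕ} (f : A →ₗ[ℂ] ℂ) {φ : Cochain A n} (hφ : φ ∈ mlSub A n) :
    (fun a => f (a 0) * φ (Fin.tail a)) ∈ mlSub A (n + 1) := by
  obtain ⟨F, rfl⟩ := hφ
  exact ⟨(f.smulRight F).uncurryLeft, rfl⟩

lemma exists_opB0L_eq {n : ℕ} {φ : Cochain A n} (hφ : φ ∈ mlSub A n) (h : lamL n φ = φ) :
    ∃ ψ ∈ mlSub A (n + 1), opB0L n ψ = (2 : ℂ) • φ := by
  rcases subsingleton_or_nontrivial A with hA | hA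
  · refine ⟨0, Submodule.zero_mem _, ?_⟩
    obtain ⟨F, rfl⟩ := hφ
    ext a
    simp [F.map_coord_zero 0 (Subsingleton.elim (a 0) 0)]
  obtain ⟨f, hf⟩ := Module.Projective.exists_dual_eq_one ℂ (one_ne_zero (α := A))
  let proj : (Fin (n + 1) → A) → Fin (n + 1) → A :=
    fun a => Function.update a 0 (a 0 - f (a 0) • 1)
  have hproj : (fun a => φ (proj a)) ∈ mlSub A n := by
    refine comp_mem_mlSub hφ proj fun a k => ?_
    by_cases hk : k = 0
    · refine ⟨k, LinearMap.id - f.smulRight 1, fun x => ?_⟩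
      subst hk
      simp [proj]
    · refine ⟨k, LinearMap.id, fun x => ?_⟩
      simp only [proj, Function.update_of_ne (Ne.symm hk), LinearMap.id_apply]
      exact Function.update_comm hk _ _ _
  refine ⟨(fun a => f (a 0) * φ (Fin.tail a)) -
      lamL (n + 1) (fun a => f (a 0) * φ (proj (Fin.tail a))),
    Submodule.sub_mem _ (tensorFirst_mem f hφ) (lamL_mem (tensorFirst_mem f hproj)), ?_⟩
  ext a
  have hfirst : φ (proj (Fin.tail fun j => (Fin.cons 1 a : Fin (n + 2) → A) (j - 1))) = 0 := by
    obtain ⟨F, rfl⟩ := hφ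
    refine F.map_coord_zero 0 ?_
    have : (Fin.succ 0 - 1 : Fin (n + 2)) = 0 := by simp
    simp [proj, Fin.tail, this, hf, -Fin.succ_zero_eq_one, -Fin.succ_zero_eq_one']
  have hrot : (fun j => (Fin.snoc a 1 : Fin (n + 2) → A) (j - 1)) = Fin.cons 1 a :=
    snoc_one_rotate a
  have hproj_apply : φ (proj a) = φ a - f (a 0) * φ (Function.update a 0 1) := by
    obtain ⟨F, rfl⟩ := hφ
    simp [proj, F.map_update_sub, F.map_update_smul]
  have htail : φ (Fin.tail (Fin.snoc a 1 : Fin (n + 2) → A)) =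
      (-1 : ℂ) ^ n * φ (Function.update a 0 1) := by
    rw [← congrFun h, lamL_apply]
    congr 2
    obtain ⟨g, rfl⟩ := exists_nat_extension a
    rw [snoc_one_eq]
    ext j
    simp only [Fin.tail, Function.update_apply, val_sub_one, Fin.ext_iff, Fin.val_succ,
      Fin.val_zero]
    grind
  have hzero : (Fin.snoc a 1 : Fin (n + 2) → A) 0 = a 0 := by
    rw [← Fin.castSucc_zero, Fin.snoc_castSucc]
  have hsign : (-1 : ℂ) ^ n * (-1) ^ n = 1 := by rw [← mul_pow]; simp
  rw [opB0L_apply, opB0, Pi.sub_apply, Pi.sub_apply, lamL_apply, lamL_apply, hfirst, hrot, hzero,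
    htail]
  simp only [Fin.cons_zero, Fin.tail_cons, hf, hproj_apply, Pi.smul_apply, smul_eq_mul, pow_succ]
  linear_combination (φ a) * hsign

lemma inImB_of_cyclic {n : ℕ} {φ : Cochain A n} (hφ : φ ∈ mlSub A n) (h : lamL n φ = φ) :
    InImB φ := by
  obtain ⟨ψ, hψ, hB⟩ := exists_opB0L_eq hφ h
  refine ⟨((n + 1 : ℂ) * 2)⁻¹ • ψ, Submodule.smul_mem _ _ hψ, ?_⟩
  have hn : (n : ℂ) + 1 ≠ 0 := Nat.cast_add_one_ne_zero n
  rw [opB_eq, map_smul, hB, map_smul, map_smul, normL_of_cyclic h, smul_smul, smul_smul]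
  convert one_smul ℂ φ using 2
  field_simp

lemma InImB.cyclic {n : ℕ} {φ : Cochain A n} (h : InImB φ) : lamL n φ = φ := by
  obtain ⟨ψ, -, rfl⟩ := h
  rw [opB_eq, lamL_normL]

lemma InImB.bHL {n : ℕ} {φ : Cochain A n} (h : InImB φ) : InImB (bHL n φ) := by
  obtain ⟨ψ, hψ, rfl⟩ := h
  refine ⟨- NCG.bHL (n + 1) ψ, Submodule.neg_mem _ (bHL_mem hψ), ?_⟩
  rw [opB_eq, map_neg, map_neg, normL_opB0L_bHL, neg_neg, opB_eq]

lemma InKerB.bHL {n : ℕ} {φ : Cochain A n} (h : InKerB φ) : InKerB (bHL n φ) := by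
  change opB (NCG.bHL n φ) = 0
  rw [opB_eq]
  cases n with
  | zero => exact normL_opB0L_bHL_zero φ
  | succ n =>
    have h' : opB φ = 0 := h
    rw [normL_opB0L_bHL, ← opB_eq, h', map_zero, neg_zero]

lemma lamL_zero (φ : Cochain A 0) : lamL 0 φ = φ := by
  simpa using LinearMap.congr_fun (lamL_pow_card (A := A) 0) φ

lemma inImB_of_degree_zero {φ : Cochain A 0} (hφ : φ ∈ mlSub A 0) : InImB φ :=
  inImB_of_cyclic hφ (lamL_zero φ)

/-- The `b'`-complex is contractible, so a `b'`-closed `B₀θ` makes `Bθ` a `b`-coboundary of a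
cyclic cochain, which can be absorbed by a Hochschild coboundary. -/
lemma exists_inKerB_bHL_eq {n : ℕ} {θ : Cochain A n} (hθ : θ ∈ mlSub A n)
    (h : ∀ m (e : n = m + 1), bPL m (opB0L m (e ▸ θ)) = 0) :
    ∃ η ∈ mlSub A n, InKerB η ∧ bHL n η = bHL n θ := by
  rcases n with _ | _ | n
  · exact ⟨θ, hθ, trivial, rfl⟩
  · refine ⟨θ, hθ, ?_, rfl⟩
    change opB θ = 0
    have h0 : bPL 0 (opB0L 0 θ) = 0 := h 0 rfl
    rw [opB_eq, ← unitFirst_bPL_zero (opB0L 0 θ), h0, map_zero, map_zero]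
  · have h0 : bPL (n + 1) (opB0L (n + 1) θ) = 0 := h (n + 1) rfl
    have h1 := unitFirst_bPL (opB0L (n + 1) θ)
    rw [h0, map_zero, eq_comm, sub_eq_zero] at h1
    have hγ := unitFirst_mem (opB0L_mem hθ)
    obtain ⟨δ, hδ, hB⟩ := inImB_of_cyclic (normL_mem hγ) (lamL_normL _)
    refine ⟨θ + bHL (n + 1) δ, Submodule.add_mem _ hθ (bHL_mem hδ), ?_, ?_⟩
    · change opB _ = 0
      rw [opB_eq, map_add, map_add, h1, normL_bPL, ← hB, normL_opB0L_bHL, opB_eq, add_neg_cancel]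
    · rw [map_add, bHL_bHL, add_zero]

lemma exists_sub_bHL_inImB {n : ℕ} {φ : Cochain A (n + 1)} (hφ : φ ∈ mlSub A (n + 1))
    (hK : InKerB φ) (hb : InImB (bHL (n + 1) φ)) :
    ∃ η ∈ mlSub A n, InKerB η ∧ InImB (φ - bHL n η) := by
  have hN : normL n (opB0L n φ) = 0 := (opB_eq φ).symm.trans hK
  set θ := coboundL n (opB0L n φ) with hθ_def
  have hθ : θ ∈ mlSub A n := coboundL_mem (opB0L_mem hφ)
  have hθφ : θ - lamL n θ = opB0L n φ := sub_lamL_coboundL hN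
  have hcyc : lamL (n + 1) (φ - bHL n θ) = φ - bHL n θ := by
    have h1 := opB0L_bHL φ
    rw [opB0L_of_cyclic hb.cyclic, ← hθφ, ← bHL_sub_lamL] at h1
    rw [map_sub, eq_comm, ← sub_eq_zero]
    rw [h1]
    abel
  have hclosed : ∀ m (e : n = m + 1), bPL m (opB0L m (e ▸ θ)) = 0 := by
    rintro m rfl
    have h1 := opB0L_of_cyclic hcyc
    rw [map_sub, opB0L_bHL, hθφ, sub_sub_cancel] at h1
    exact h1
  obtain ⟨η, hη, hηK, hηb⟩ := exists_inKerB_bHL_eq hθ hclosed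
  refine ⟨η, hη, hηK, ?_⟩
  rw [hηb]
  exact inImB_of_cyclic (Submodule.sub_mem _ hφ (bHL_mem hθ)) hcyc

/-- Lemma 41 of Connes' "Noncommutative differential geometry": `Im B` and
`Ker B` are stable under the Hochschild differential `b` (conjuncts 1 and 2),
the inclusion `(Im B, b) ↪ (Ker B, b)` induces an isomorphism on cohomology in
every degree (conjuncts 3–5: surjectivity in degree `0` and in degrees `≥ 1`,
then injectivity), and consequently the `b`-cohomology of the quotient complex
`Ker B / Im B` vanishes in every degree (conjuncts 6 and 7). -/
theorem imB_into_kerB_is_quasi_iso (A : Type) [Ring A] [Algebra ℂ A] :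
    -- Im B is stable under b
    (∀ (n : ℕ) (φ : Cochain A n), IsML φ → InImB φ → InImB (bH φ)) ∧
    -- Ker B is stable under b
    (∀ (n : ℕ) (φ : Cochain A n), IsML φ → InKerB φ → InKerB (bH φ)) ∧
    -- surjectivity of H(Im B) → H(Ker B), degree 0
    (∀ φ : Cochain A 0, IsML φ → bH φ = 0 → InImB φ) ∧
    -- surjectivity of H(Im B) → H(Ker B), degree n + 1
    (∀ (n : ℕ) (φ : Cochain A (n + 1)), IsML φ → InKerB φ → bH φ = 0 →
      ∃ (φ' : Cochain A (n + 1)) (η : Cochain A n),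
        IsML φ' ∧ InImB φ' ∧ IsML η ∧ InKerB η ∧ φ = φ' + bH η) ∧
    -- injectivity of H(Im B) → H(Ker B)
    (∀ (n : ℕ) (φ : Cochain A (n + 1)), IsML φ → InImB φ →
      (∃ η : Cochain A n, IsML η ∧ InKerB η ∧ bH η = φ) →
      ∃ η' : Cochain A n, IsML η' ∧ InImB η' ∧ bH η' = φ) ∧
    -- vanishing of H_b(Ker B / Im B), degree 0
    (∀ φ : Cochain A 0, IsML φ → InImB (bH φ) → InImB φ) ∧
    -- vanishing of H_b(Ker B / Im B), degree n + 1
    (∀ (n : ℕ) (φ : Cochain A (n + 1)), IsML φ → InKerB φ → InImB (bH φ) →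
      ∃ η : Cochain A n, IsML η ∧ InKerB η ∧ InImB (φ - bH η)) := by

  simp only [← bHL_apply, ← mem_mlSub]
  refine ⟨fun n φ _ h => h.bHL, fun n φ _ h => h.bHL, fun φ hφ _ => inImB_of_degree_zero hφ,
    fun n φ hφ hK hb => ?_, ?_, fun φ hφ _ => inImB_of_degree_zero hφ,
    fun n φ hφ hK hb => exists_sub_bHL_inImB hφ hK hb⟩
  · obtain ⟨η, hη, hηK, hηI⟩ := exists_sub_bHL_inImB hφ hK
      (hb ▸ inImB_of_cyclic (Submodule.zero_mem _) (map_zero _))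
    exact ⟨φ - bHL n η, η, Submodule.sub_mem _ hφ (bHL_mem hη), hηI, hη, hηK,
      (sub_add_cancel _ _).symm⟩
  · rintro n φ - hI ⟨η, hη, hηK, rfl⟩
    cases n with
    | zero => exact ⟨η, hη, inImB_of_degree_zero hη, rfl⟩
    | succ n =>
      obtain ⟨ζ, hζ, -, hI'⟩ := exists_sub_bHL_inImB hη hηK hI
      exact ⟨η - bHL n ζ, Submodule.sub_mem _ hη (bHL_mem hζ), hI',
        by rw [map_sub, bHL_bHL, sub_zero]⟩

end NCG
end
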